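/- arXiv:2209.10467 — 8 statements merged into one kernel-verified Lean document; each statement's English description precedes it below -/
import Mathlib

section
/- Let 0 < c < 1, let γ, γ̃ : ℝ → H² be smooth unit-speed curves (⟪γ',γ'⟫ = ⟪γ̃',γ̃'⟫ = 1) with unit normal fields N, Ñ (⟪N,N⟫ = ⟪Ñ,Ñ⟫ = 1, ⟪N,γ⟫ = ⟪N,γ'⟫ = 0, ⟪Ñ,γ̃⟫ = ⟪Ñ,γ̃'⟫ = 0). Define Φ(t,r,s) = (p(t,r), q(t,s)) where p(t,r) = cosh(√c t)γ(r) + sinh(√c t)N(r) and q(t,s) = cosh(√(1−c) t)γ̃(s) + sinh(√(1−c) t)Ñ(s), and define 𝒩(t,r,s) = (√(1−c)(sinh(√c t)γ(r) + cosh(√c t)N(r)), −√c(sinh(√(1−c) t)γ̃(s) + cosh(√(1−c) t)Ñ(s))). Then ⟪p,p⟫ = ⟪q,q⟫ = −1, ⟨𝒩,𝒩⟩ = 1, ⟨𝒩, ∂Φ/∂t⟩ = ⟨𝒩, ∂Φ/∂r⟩ = ⟨𝒩, ∂Φ/∂s⟩ = 0, and ⟨P𝒩, 𝒩⟩ = 1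 − 2c. -/
noncomputable section

/-- Vectors in ℝ³ (written as triples). -/
abbrev V3 : Type := ℝ × ℝ × ℝ

/-- The Minkowski bilinear form ⟪x,y⟫ = −x₁y₁ + x₂y₂ + x₃y₃ on ℝ³₁. -/
def mink (x y : V3) : ℝ := -(x.1 * y.1) + x.2.1 * y.2.1 + x.2.2 * y.2.2

/-- The Lorentzian cross product a ⊠ b = (a₃b₂ − a₂b₃, a₃b₁ − a₁b₃, a₁b₂ − a₂b₁). -/
def lcross (a b : V3) : V3 :=
  (a.2.2 * b.2.1 - a.2.1 * b.2.2, a.2.2 * b.1 - a.1 * b.2.2, a.1 * b.2.1 - a.2.1 * b.1)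

/-- The hyperbolic plane H² = {x ∈ ℝ³₁ : ⟪x,x⟫ = −1, x₁ > 0}. -/
def H2 : Set V3 := {x | mink x x = -1 ∧ 0 < x.1}

/-- The product metric ⟨(x,y),(x',y')⟩ = ⟪x,x'⟫ + ⟪y,y'⟫ on ℝ³ × ℝ³. -/
def pInner (v w : V3 × V3) : ℝ := mink v.1 w.1 + mink v.2 w.2

/-- The product structure P(v₁,v₂) = (v₁,−v₂). -/
def Pstr (v : V3 × V3) : V3 × V3 := (v.1, -v.2)

theorem mink_comm (x y : V3) : mink x y = mink y x := by
  simp only [mink]; ring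

theorem mink_add_left (x y z : V3) : mink (x + y) z = mink x z + mink y z := by
  simp only [mink, Prod.fst_add, Prod.snd_add]; ring

theorem mink_smul_left (a : ℝ) (x y : V3) : mink (a • x) y = a * mink x y := by
  simp only [mink, Prod.smul_fst, Prod.smul_snd, smul_eq_mul]; ring

theorem mink_neg_left (x y : V3) : mink (-x) y = -mink x y := by
  simp only [mink, Prod.fst_neg, Prod.snd_neg]; ring

theorem mink_add_right (x y z : V3) : mink x (y + z) = mink x y + mink x z := by
  rw [mink_comm, mink_add_left, mink_comm y, mink_comm z]

theorem mink_smul_right (a : ℝ) (x y : V3) : mink x (a • y) = a * mink x y := by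
  rw [mink_comm, mink_smul_left, mink_comm y]

theorem mink_neg_right (x y : V3) : mink x (-y) = -mink x y := by
  rw [mink_comm, mink_neg_left, mink_comm y]

theorem mink_zero_right (x : V3) : mink x 0 = 0 := by
  simp [mink]

/-- The product rule for the Minkowski form. -/
theorem HasDerivAt.mink {f g : ℝ → V3} {f' g' : V3} {r : ℝ}
    (hf : HasDerivAt f f' r) (hg : HasDerivAt g g' r) :
    HasDerivAt (fun u => mink (f u) (g u)) (mink f' (g r) + mink (f r) g') r := by
  have hf₁ : HasDerivAt (fun u => (f u).1) f'.1 r := hf.fst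
  have hf₂ : HasDerivAt (fun u => (f u).2.1) f'.2.1 r := hf.snd.fst
  have hf₃ : HasDerivAt (fun u => (f u).2.2) f'.2.2 r := hf.snd.snd
  have hg₁ : HasDerivAt (fun u => (g u).1) g'.1 r := hg.fst
  have hg₂ : HasDerivAt (fun u => (g u).2.1) g'.2.1 r := hg.snd.fst
  have hg₃ : HasDerivAt (fun u => (g u).2.2) g'.2.2 r := hg.snd.snd
  have h := ((hf₁.mul hg₁).neg.add (hf₂.mul hg₂)).add (hf₃.mul hg₃)
  refine h.congr_deriv ?_
  simp only [_root_.mink]; ring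

/-- If `⟪f, g⟫` is constant, its derivative given by the product rule vanishes. -/
theorem mink_deriv_add_eq_zero {f g : ℝ → V3} (hf : Differentiable ℝ f)
    (hg : Differentiable ℝ g) {k : ℝ} (h : ∀ u, mink (f u) (g u) = k) (r : ℝ) :
    mink (deriv f r) (g r) + mink (f r) (deriv g r) = 0 := by
  have hd := (hf r).hasDerivAt.mink (hg r).hasDerivAt
  simp only [h] at hd
  exact hd.unique (hasDerivAt_const r k)

/-- The Minkowski form on the normal plane spanned by `x ∈ H²` and a unit normal `n`. -/
theorem mink_normal_plane {x n : V3} (hx : mink x x = -1) (hn : mink n n = 1)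
    (hnx : mink n x = 0) (a b a' b' : ℝ) :
    mink (a • x + b • n) (a' • x + b' • n) = b * b' - a * a' := by
  simp only [mink_add_left, mink_add_right, mink_smul_left, mink_smul_right, hx, hn, hnx,
    mink_comm x n]
  ring

/-- The normal plane of a curve in `H²` is orthogonal to the velocity of its parallel curves. -/
theorem mink_normal_plane_deriv {γ N : ℝ → V3} (hγ : Differentiable ℝ γ)
    (hN : Differentiable ℝ N) (hγγ : ∀ r, mink (γ r) (γ r) = -1)
    (hNN : ∀ r, mink (N r) (N r) = 1) (hNγ : ∀ r, mink (N r) (γ r) = 0)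
    (hNγ' : ∀ r, mink (N r) (deriv γ r) = 0) (a b a' b' r : ℝ) :
    mink (a • γ r + b • N r) (a' • deriv γ r + b' • deriv N r) = 0 := by
  have h1 := mink_deriv_add_eq_zero hγ hγ hγγ r
  have h2 := mink_deriv_add_eq_zero hN hN hNN r
  have h3 := mink_deriv_add_eq_zero hN hγ hNγ r
  rw [mink_comm (deriv γ r)] at h1
  rw [mink_comm (deriv N r)] at h2
  rw [mink_comm (deriv N r), hNγ'] at h3
  simp only [mink_add_left, mink_add_right, mink_smul_left, mink_smul_right, hNγ']
  linear_combination a * a' / 2 * h1 + b * b' / 2 * h2 + a * b' * h3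

/-- Velocity of the geodesic `t ↦ cosh (k t) x + sinh (k t) n`. -/
theorem hasDerivAt_cosh_smul_add_sinh_smul (k t : ℝ) (x n : V3) :
    HasDerivAt (fun u => Real.cosh (k * u) • x + Real.sinh (k * u) • n)
      (k • (Real.sinh (k * t) • x + Real.cosh (k * t) • n)) t := by
  have hk : HasDerivAt (fun u => k * u) k t := by
    simpa using (hasDerivAt_id t).const_mul k
  refine ((hk.cosh.smul_const x).add (hk.sinh.smul_const n)).congr_deriv ?_
  module

/-- The immersion Φ(t,r,s) = (p(t,r), q(t,s)) built from two
unit-speed curves of H² with unit normal fields maps into H²×H², the field 𝒩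
is a unit normal field along it, and the product angle function is 1 − 2c. -/
theorem immersion_M_c_kappa_kappatilde (c : ℝ) (hc0 : 0 < c) (hc1 : c < 1)
    (γ γt N Nt : ℝ → V3)
    (hγsm : ContDiff ℝ (⊤ : ℕ∞) γ) (hγtsm : ContDiff ℝ (⊤ : ℕ∞) γt)
    (hNsm : ContDiff ℝ (⊤ : ℕ∞) N) (hNtsm : ContDiff ℝ (⊤ : ℕ∞) Nt)
    (hγH : ∀ r, γ r ∈ H2) (hγtH : ∀ s, γt s ∈ H2)
    (hunit : ∀ r, mink (deriv γ r) (deriv γ r) = 1)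
    (htunit : ∀ s, mink (deriv γt s) (deriv γt s) = 1)
    (hNN : ∀ r, mink (N r) (N r) = 1)
    (hNγ : ∀ r, mink (N r) (γ r) = 0)
    (hNγ' : ∀ r, mink (N r) (deriv γ r) = 0)
    (hNtNt : ∀ s, mink (Nt s) (Nt s) = 1)
    (hNtγt : ∀ s, mink (Nt s) (γt s) = 0)
    (hNtγt' : ∀ s, mink (Nt s) (deriv γt s) = 0)
    (p q : ℝ → ℝ → V3)
    (hp : ∀ t r, p t r =
      Real.cosh (Real.sqrt c * t) • γ r + Real.sinh (Real.sqrt c * t) • N r)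
    (hq : ∀ t s, q t s =
      Real.cosh (Real.sqrt (1 - c) * t) • γt s + Real.sinh (Real.sqrt (1 - c) * t) • Nt s)
    (Φ : ℝ → ℝ → ℝ → V3 × V3) (hΦ : ∀ t r s, Φ t r s = (p t r, q t s))
    (𝒩 : ℝ → ℝ → ℝ → V3 × V3)
    (h𝒩 : ∀ t r s, 𝒩 t r s =
      (Real.sqrt (1 - c) •
          (Real.sinh (Real.sqrt c * t) • γ r + Real.cosh (Real.sqrt c * t) • N r),
       -(Real.sqrt c •
          (Real.sinh (Real.sqrt (1 - c) * t) • γt s +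
            Real.cosh (Real.sqrt (1 - c) * t) • Nt s)))) :
    ∀ t r s,
      mink (p t r) (p t r) = -1 ∧
      mink (q t s) (q t s) = -1 ∧
      pInner (𝒩 t r s) (𝒩 t r s) = 1 ∧
      pInner (𝒩 t r s) (deriv (fun t' => Φ t' r s) t) = 0 ∧
      pInner (𝒩 t r s) (deriv (fun r' => Φ t r' s) r) = 0 ∧
      pInner (𝒩 t r s) (deriv (fun s' => Φ t r s') s) = 0 ∧
      pInner (Pstr (𝒩 t r s)) (𝒩 t r s) = 1 - 2 * c := by
  have hγγ r : mink (γ r) (γ r) = -1 := (hγH r).1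
  have hγtγt s : mink (γt s) (γt s) = -1 := (hγtH s).1
  have hγd : Differentiable ℝ γ := hγsm.differentiable (by simp)
  have hγtd : Differentiable ℝ γt := hγtsm.differentiable (by simp)
  have hNd : Differentiable ℝ N := hNsm.differentiable (by simp)
  have hNtd : Differentiable ℝ Nt := hNtsm.differentiable (by simp)
  intro t r s
  have hsc : √c * √c = c := Real.mul_self_sqrt hc0.le
  have hsc' : √(1 - c) * √(1 - c) = 1 - c := Real.mul_self_sqrt (by linarith)
  have hcs := Real.cosh_sq (√c * t)
  have hcs' := Real.cosh_sq (√(1 - c) * t)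
  have hplane := mink_normal_plane (hγγ r) (hNN r) (hNγ r)
  have hplane' := mink_normal_plane (hγtγt s) (hNtNt s) (hNtγt s)
  have hdt := ((hasDerivAt_cosh_smul_add_sinh_smul √c t (γ r) (N r)).prodMk
    (hasDerivAt_cosh_smul_add_sinh_smul √(1 - c) t (γt s) (Nt s))).deriv
  have hdr := (((hγd r).hasDerivAt.fun_const_smul (Real.cosh (√c * t))).fun_add
    ((hNd r).hasDerivAt.fun_const_smul (Real.sinh (√c * t)))).prodMk
    (hasDerivAt_const r (q t s)) |>.deriv
  have hds := (hasDerivAt_const s (p t r)).prodMk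
    (((hγtd s).hasDerivAt.fun_const_smul (Real.cosh (√(1 - c) * t))).fun_add
    ((hNtd s).hasDerivAt.fun_const_smul (Real.sinh (√(1 - c) * t)))) |>.deriv
  simp only [← hp, ← hq, ← hΦ] at hdt hdr hds
  rw [hdt, hdr, hds]
  simp only [h𝒩, hp, hq, pInner, Pstr, mink_neg_left, mink_neg_right, mink_smul_left,
    mink_smul_right, mink_zero_right, hplane, hplane',
    mink_normal_plane_deriv hγd hNd hγγ hNN hNγ hNγ',
    mink_normal_plane_deriv hγtd hNtd hγtγt hNtNt hNtγt hNtγt']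
  refine ⟨?_, ?_, ?_, ?_, ?_, ?_, ?_⟩
  · linear_combination -hcs
  · linear_combination -hcs'
  · linear_combination √(1 - c) * √(1 - c) * hcs + √c * √c * hcs' + hsc + hsc'
  · linear_combination √(1 - c) * √c * (hcs - hcs')
  · ring
  · ring
  · linear_combination √(1 - c) * √(1 - c) * hcs - √c * √c * hcs' + hsc' - hsc
end
end

section
/- In the situation of the immersion Φ(t,r,s) = (p(t,r), q(t,s)) with unit normal 𝒩 of the hypersurface M^c_{κ,κ̃}, let κ(r) = ⟪γ''(r), N(r)⟫ and κ̃(s) = ⟪γ̃''(s), Ñ(s)⟫ denote the curvatures of the generating curves. Then: (i) ∂𝒩/∂t = √(c(1−c))·(p, −q); (ii) at every point where cosh(√c t) − sinh(√c t)κ(r) ≠ 0, ∂𝒩/∂r = −λ₂·∂Φ/∂r with λ₂ = −√(1−c)·(sinh(√c t) − cosh(√c t)κ(r))/(cosh(√c t) − sinh(√c t)κ(r)); (iii) at every point where cosh(√(1−c) t) − sinh(√(1−c) t)κ̃(s) ≠ 0, ∂𝒩/∂s = −λ₃·∂Φ/∂s with λ₃ = √c·(sinh(√(1−c) t) − cosh(√(1−c)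 t)κ̃(s))/(cosh(√(1−c) t) − sinh(√(1−c) t)κ̃(s)). Hence the principal curvatures of M^c_{κ,κ̃} are 0, λ₂ and λ₃. -/
noncomputable section

theorem hasDerivAt_mink {x y : ℝ → V3} {x' y' : V3} {t : ℝ}
    (hx : HasDerivAt x x' t) (hy : HasDerivAt y y' t) :
    HasDerivAt (fun u => mink (x u) (y u)) (mink x' (y t) + mink (x t) y') t := by
  have hcoord : ∀ {z : ℝ → V3} {z' : V3}, HasDerivAt z z' t →
      HasDerivAt (fun u => (z u).1) z'.1 t ∧ HasDerivAt (fun u => (z u).2.1) z'.2.1 t ∧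
        HasDerivAt (fun u => (z u).2.2) z'.2.2 t := by
    intro z z' hz
    have h := HasDerivAt.hasFDerivAt hz
    exact ⟨by simpa using h.fst.hasDerivAt, by simpa using h.snd.fst.hasDerivAt,
      by simpa using h.snd.snd.hasDerivAt⟩
  obtain ⟨hx1, hx2, hx3⟩ := hcoord hx
  obtain ⟨hy1, hy2, hy3⟩ := hcoord hy
  refine (((hx1.mul hy1).neg.add (hx2.mul hy2)).add (hx3.mul hy3)).congr_deriv ?_
  simp only [mink]
  ring

/-- A pair of curves with constant product has antisymmetric first-order products. -/
theorem mink_deriv_add_eq_zero_s6 {x y : ℝ → V3} {a : ℝ} (hx : Differentiable ℝ x)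
    (hy : Differentiable ℝ y) (h : ∀ u, mink (x u) (y u) = a) (t : ℝ) :
    mink (deriv x t) (y t) + mink (x t) (deriv y t) = 0 := by
  have h1 := hasDerivAt_mink (hx t).hasDerivAt (hy t).hasDerivAt
  rw [funext h] at h1
  exact h1.unique (hasDerivAt_const t a)

/-- The Minkowski form is nondegenerate on a pseudo-orthonormal frame. -/
theorem eq_zero_of_mink_frame_eq_zero {a b n w : V3}
    (haa : mink a a = -1) (hbb : mink b b = 1) (hnn : mink n n = 1)
    (hab : mink a b = 0) (hna : mink n a = 0) (hnb : mink n b = 0)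
    (hwa : mink w a = 0) (hwb : mink w b = 0) (hwn : mink w n = 0) : w = 0 := by
  obtain ⟨a1, a2, a3⟩ := a
  obtain ⟨b1, b2, b3⟩ := b
  obtain ⟨n1, n2, n3⟩ := n
  obtain ⟨w1, w2, w3⟩ := w
  set D := a1 * (b2 * n3 - b3 * n2) - a2 * (b1 * n3 - b3 * n1) + a3 * (b1 * n2 - b2 * n1)
    with hD
  have hgram : D ^ 2 = -(mink (a1, a2, a3) (a1, a2, a3) *
        (mink (b1, b2, b3) (b1, b2, b3) * mink (n1, n2, n3) (n1, n2, n3) -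
          mink (n1, n2, n3) (b1, b2, b3) ^ 2) -
      mink (a1, a2, a3) (b1, b2, b3) *
        (mink (a1, a2, a3) (b1, b2, b3) * mink (n1, n2, n3) (n1, n2, n3) -
          mink (n1, n2, n3) (b1, b2, b3) * mink (n1, n2, n3) (a1, a2, a3)) +
      mink (n1, n2, n3) (a1, a2, a3) *
        (mink (a1, a2, a3) (b1, b2, b3) * mink (n1, n2, n3) (b1, b2, b3) -
          mink (b1, b2, b3) (b1, b2, b3) * mink (n1, n2, n3) (a1, a2, a3))) := by
    simp only [hD, mink]
    ring
  rw [haa, hbb, hnn, hab, hna, hnb] at hgram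
  have hD0 : D ≠ 0 := by
    intro h
    rw [h] at hgram
    norm_num at hgram
  simp only [mink] at hwa hwb hwn
  have h1 : D * w1 = 0 := by
    linear_combination -(b2 * n3 - b3 * n2) * hwa - (a3 * n2 - a2 * n3) * hwb
      - (a2 * b3 - a3 * b2) * hwn
  have h2 : D * w2 = 0 := by
    linear_combination (b3 * n1 - b1 * n3) * hwa + (a1 * n3 - a3 * n1) * hwb
      + (a3 * b1 - a1 * b3) * hwn
  have h3 : D * w3 = 0 := by
    linear_combination (b1 * n2 - b2 * n1) * hwa + (a2 * n1 - a1 * n2) * hwb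
      + (a1 * b2 - a2 * b1) * hwn
  simp only [mul_eq_zero, hD0, false_or] at h1 h2 h3
  simp [h1, h2, h3]

/-- Frenet equation for the unit normal of a unit-speed curve in the hyperbolic plane. -/
theorem deriv_normal_eq_neg_curvature_smul {γ N : ℝ → V3}
    (hγsm : ContDiff ℝ (⊤ : ℕ∞) γ) (hNsm : ContDiff ℝ (⊤ : ℕ∞) N)
    (hγH : ∀ r, γ r ∈ H2)
    (hunit : ∀ r, mink (deriv γ r) (deriv γ r) = 1)
    (hNN : ∀ r, mink (N r) (N r) = 1)
    (hNγ : ∀ r, mink (N r) (γ r) = 0)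
    (hNγ' : ∀ r, mink (N r) (deriv γ r) = 0) (r : ℝ) :
    deriv N r = -mink (deriv (deriv γ) r) (N r) • deriv γ r := by
  have dγ : Differentiable ℝ γ := hγsm.differentiable (by simp)
  have dN : Differentiable ℝ N := hNsm.differentiable (by simp)
  have dγ' : Differentiable ℝ (deriv γ) :=
    ((contDiff_infty_iff_deriv.1 hγsm).2).differentiable (by simp)
  have e1 := mink_deriv_add_eq_zero_s6 dγ dγ (fun u => (hγH u).1) r
  have e2 := mink_deriv_add_eq_zero_s6 dN dN hNN r
  have e3 := mink_deriv_add_eq_zero_s6 dN dγ hNγ r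
  have e4 := mink_deriv_add_eq_zero_s6 dN dγ' hNγ' r
  have f1 := hunit r
  have f2 := hNγ' r
  set k := mink (deriv (deriv γ) r) (N r) with hk
  rw [mink_comm] at hk
  rw [← hk] at e4
  have hab : mink (γ r) (deriv γ r) = 0 := by
    rw [mink_comm (deriv γ r)] at e1
    linarith
  have hsmul : ∀ z, mink (deriv N r + k • deriv γ r) z
      = mink (deriv N r) z + k * mink (deriv γ r) z := by
    intro z
    simp only [mink, Prod.fst_add, Prod.snd_add, Prod.smul_fst, Prod.smul_snd, smul_eq_mul]
    ring
  rw [neg_smul, eq_neg_iff_add_eq_zero]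
  refine eq_zero_of_mink_frame_eq_zero (hγH r).1 f1 (hNN r) hab (hNγ r) f2 ?_ ?_ ?_
  · rw [hsmul, mink_comm (deriv γ r), hab]
    linarith
  · rw [hsmul, f1]
    linarith
  · rw [hsmul, mink_comm (deriv γ r), f2]
    rw [mink_comm (N r)] at e2
    linarith

theorem hasDerivAt_smul_add_smul_normal {γ N : ℝ → V3} {r k : ℝ} (a b : ℝ)
    (hγ : DifferentiableAt ℝ γ r) (hN : DifferentiableAt ℝ N r)
    (h : deriv N r = -k • deriv γ r) :
    HasDerivAt (fun u => a • γ u + b • N u) ((a - b * k) • deriv γ r) r := by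
  refine ((hγ.hasDerivAt.const_smul a).add (hN.hasDerivAt.const_smul b)).congr_deriv ?_
  rw [h]
  module

theorem hasDerivAt_sinh_smul_add_cosh_smul (a t : ℝ) (x y : V3) :
    HasDerivAt (fun u => Real.sinh (a * u) • x + Real.cosh (a * u) • y)
      (a • (Real.cosh (a * t) • x + Real.sinh (a * t) • y)) t := by
  have h : HasDerivAt (fun u => a * u) a t := by simpa using (hasDerivAt_id t).const_mul a
  refine ((h.sinh.smul_const x).add (h.cosh.smul_const y)).congr_deriv ?_
  module

/-- For the immersion Φ with unit normal 𝒩 of M^c_{κ,κ̃}, the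
Weingarten relations hold: ∂𝒩/∂t = √(c(1−c))·(p,−q); where the denominators do
not vanish, ∂𝒩/∂r = −λ₂·∂Φ/∂r and ∂𝒩/∂s = −λ₃·∂Φ/∂s with the displayed λ₂, λ₃.
Hence the principal curvatures of M^c_{κ,κ̃} are 0, λ₂ and λ₃. -/
theorem principal_curvatures_M_c_kappa_kappatilde (c : ℝ) (hc0 : 0 < c) (hc1 : c < 1)
    (γ γt N Nt : ℝ → V3)
    (hγsm : ContDiff ℝ (⊤ : ℕ∞) γ) (hγtsm : ContDiff ℝ (⊤ : ℕ∞) γt)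
    (hNsm : ContDiff ℝ (⊤ : ℕ∞) N) (hNtsm : ContDiff ℝ (⊤ : ℕ∞) Nt)
    (hγH : ∀ r, γ r ∈ H2) (hγtH : ∀ s, γt s ∈ H2)
    (hunit : ∀ r, mink (deriv γ r) (deriv γ r) = 1)
    (htunit : ∀ s, mink (deriv γt s) (deriv γt s) = 1)
    (hNN : ∀ r, mink (N r) (N r) = 1)
    (hNγ : ∀ r, mink (N r) (γ r) = 0)
    (hNγ' : ∀ r, mink (N r) (deriv γ r) = 0)
    (hNtNt : ∀ s, mink (Nt s) (Nt s) = 1)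
    (hNtγt : ∀ s, mink (Nt s) (γt s) = 0)
    (hNtγt' : ∀ s, mink (Nt s) (deriv γt s) = 0)
    (κ : ℝ → ℝ) (hκ : ∀ r, κ r = mink (deriv (deriv γ) r) (N r))
    (κt : ℝ → ℝ) (hκt : ∀ s, κt s = mink (deriv (deriv γt) s) (Nt s))
    (p q : ℝ → ℝ → V3)
    (hp : ∀ t r, p t r =
      Real.cosh (Real.sqrt c * t) • γ r + Real.sinh (Real.sqrt c * t) • N r)
    (hq : ∀ t s, q t s =
      Real.cosh (Real.sqrt (1 - c) * t) • γt s + Real.sinh (Real.sqrt (1 - c) * t) • Nt s)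
    (Φ : ℝ → ℝ → ℝ → V3 × V3) (hΦ : ∀ t r s, Φ t r s = (p t r, q t s))
    (𝒩 : ℝ → ℝ → ℝ → V3 × V3)
    (h𝒩 : ∀ t r s, 𝒩 t r s =
      (Real.sqrt (1 - c) •
          (Real.sinh (Real.sqrt c * t) • γ r + Real.cosh (Real.sqrt c * t) • N r),
       -(Real.sqrt c •
          (Real.sinh (Real.sqrt (1 - c) * t) • γt s +
            Real.cosh (Real.sqrt (1 - c) * t) • Nt s)))) :
    ∀ t r s,
      (deriv (fun t' => 𝒩 t' r s) t
        = Real.sqrt (c * (1 - c)) • ((p t r, -(q t s)) : V3 × V3)) ∧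
      (Real.cosh (Real.sqrt c * t) - Real.sinh (Real.sqrt c * t) * κ r ≠ 0 →
        deriv (fun r' => 𝒩 t r' s) r
          = -(-(Real.sqrt (1 - c)) *
              ((Real.sinh (Real.sqrt c * t) - Real.cosh (Real.sqrt c * t) * κ r) /
               (Real.cosh (Real.sqrt c * t) - Real.sinh (Real.sqrt c * t) * κ r))) •
            deriv (fun r' => Φ t r' s) r) ∧
      (Real.cosh (Real.sqrt (1 - c) * t) - Real.sinh (Real.sqrt (1 - c) * t) * κt s ≠ 0 →
        deriv (fun s' => 𝒩 t r s') s
          = -(Real.sqrt c *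
              ((Real.sinh (Real.sqrt (1 - c) * t) - Real.cosh (Real.sqrt (1 - c) * t) * κt s) /
               (Real.cosh (Real.sqrt (1 - c) * t) - Real.sinh (Real.sqrt (1 - c) * t) * κt s))) •
            deriv (fun s' => Φ t r s') s) := by
  intro t r s
  have dγ := hγsm.differentiable (by simp) r
  have dγt := hγtsm.differentiable (by simp) s
  have dN := hNsm.differentiable (by simp) r
  have dNt := hNtsm.differentiable (by simp) s
  have fN := deriv_normal_eq_neg_curvature_smul hγsm hNsm hγH hunit hNN hNγ hNγ' r
  have fNt := deriv_normal_eq_neg_curvature_smul hγtsm hNtsm hγtH htunit hNtNt hNtγt hNtγt' s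
  rw [← hκ] at fN
  rw [← hκt] at fNt
  simp only [h𝒩, hΦ, hp, hq]
  refine ⟨?_, fun hne => ?_, fun hne => ?_⟩
  · refine HasDerivAt.deriv (HasDerivAt.congr_deriv (HasDerivAt.prodMk
      ((hasDerivAt_sinh_smul_add_cosh_smul (√c) t (γ r) (N r)).const_smul (√(1 - c)))
      ((hasDerivAt_sinh_smul_add_cosh_smul (√(1 - c)) t (γt s) (Nt s)).const_smul (√c)).neg) ?_)
    rw [Real.sqrt_mul hc0.le]
    refine Eq.trans ?_ (Prod.smul_mk _ _ _).symm
    congr 1 <;> module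
  · have hΦr := HasDerivAt.prodMk (hasDerivAt_smul_add_smul_normal (Real.cosh (√c * t))
      (Real.sinh (√c * t)) dγ dN fN) (hasDerivAt_const r
        (Real.cosh (√(1 - c) * t) • γt s + Real.sinh (√(1 - c) * t) • Nt s))
    rw [HasDerivAt.deriv hΦr]
    refine HasDerivAt.deriv (HasDerivAt.congr_deriv (HasDerivAt.prodMk
      ((hasDerivAt_smul_add_smul_normal _ _ dγ dN fN).const_smul (√(1 - c)))
      (hasDerivAt_const r _)) ?_)
    refine Eq.trans ?_ (Prod.smul_mk _ _ _).symm
    rw [smul_zero, smul_smul, smul_smul]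
    congr 2
    field_simp
  · have hΦs := HasDerivAt.prodMk (hasDerivAt_const s
      (Real.cosh (√c * t) • γ r + Real.sinh (√c * t) • N r))
      (hasDerivAt_smul_add_smul_normal (Real.cosh (√(1 - c) * t))
        (Real.sinh (√(1 - c) * t)) dγt dNt fNt)
    rw [HasDerivAt.deriv hΦs]
    refine HasDerivAt.deriv (HasDerivAt.congr_deriv (HasDerivAt.prodMk (hasDerivAt_const s _)
      ((hasDerivAt_smul_add_smul_normal _ _ dγt dNt fNt).const_smul (√c)).neg) ?_)
    refine Eq.trans ?_ (Prod.smul_mk _ _ _).symm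
    rw [smul_zero, smul_smul, smul_smul, ← neg_smul]
    congr 2
    field_simp
end
end

section
/- Let τ < −1 and p, q ∈ H² with ⟪p,q⟫ = τ, and define A(v₁,v₂) = (1/√(2(τ²−1)))·[−(v₂,v₁) − τ(v₁,v₂) − ⟪p,v₂⟫·(p,−q)] for (v₁,v₂) ∈ ℝ³ × ℝ³. Then A(p ⊠ q, q ⊠ p) = √((τ−1)/(2(τ+1)))·(p ⊠ q, q ⊠ p); that is, J₁N = (p ⊠ q, q ⊠ p)/√(2(τ²−1)) is a principal curvature vector of the hypersurface M_τ with principal curvature √((τ−1)/(2(τ+1))). -/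
noncomputable section

theorem lcross_swap (a b : V3) : lcross b a = -lcross a b := by
  ext <;> simp [lcross] <;> ring

theorem mink_lcross_self_right (a b : V3) : mink a (lcross b a) = 0 := by
  simp only [mink, lcross]
  ring

theorem inv_sqrt_mul_one_sub {τ : ℝ} (hτ : τ < -1) :
    (Real.sqrt (2 * (τ ^ 2 - 1)))⁻¹ * (1 - τ) = Real.sqrt ((τ - 1) / (2 * (τ + 1))) := by
  have h : 0 < 2 * (τ ^ 2 - 1) := by nlinarith
  have h₁ : τ + 1 ≠ 0 := by linarith
  have h₂ : τ - 1 ≠ 0 := by linarith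
  have hfac : (τ - 1) / (2 * (τ + 1)) = (1 - τ) ^ 2 / (2 * (τ ^ 2 - 1)) := by
    rw [show 2 * (τ ^ 2 - 1) = 2 * (τ + 1) * (τ - 1) by ring]
    field_simp
    ring
  rw [hfac, Real.sqrt_div (sq_nonneg _), Real.sqrt_sq (by linarith), div_eq_inv_mul]

/-- For τ < −1, (p,q) ∈ M_τ and the shape operator
A(v₁,v₂) = [−(v₂,v₁) − τ(v₁,v₂) − ⟪p,v₂⟫(p,−q)]/√(2(τ²−1)), the vector
(p ⊠ q, q ⊠ p) (proportional to J₁N) is a principal curvature vector with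
principal curvature √((τ−1)/(2(τ+1))). -/
theorem J1N_principal_curvature_vector_of_M_tau (τ : ℝ) (hτ : τ < -1) (p q : V3)
    (hp : p ∈ H2) (hq : q ∈ H2) (hpq : mink p q = τ)
    (A : V3 × V3 → V3 × V3)
    (hA : ∀ v : V3 × V3, A v = (Real.sqrt (2 * (τ ^ 2 - 1)))⁻¹ •
      (-((v.2, v.1) : V3 × V3) - τ • v - mink p v.2 • ((p, -q) : V3 × V3))) :
    A (lcross p q, lcross q p)
      = Real.sqrt ((τ - 1) / (2 * (τ + 1))) • ((lcross p q, lcross q p) : V3 × V3) := by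
  rw [hA, ← inv_sqrt_mul_one_sub hτ, mul_smul, mink_lcross_self_right, lcross_swap p q]
  congr 1
  ext <;> simp <;> ring
end
end

section
/- Let p ∈ H², let v ∈ ℝ³ with ⟪p,v⟫ = 0 and ⟪v,v⟫ = 1/2, and for l ∈ ℝ set x = cosh(l/√2)·p + √2·sinh(l/√2)·v and y = cosh(l/√2)·p − √2·sinh(l/√2)·v. Then x ∈ H², y ∈ H², and ⟪x,y⟫ = −cosh(√2·l). Consequently, the tube of radius l over the diagonal surface {(p,p) : p ∈ H²} lies in the hypersurface M_τ with τ = −cosh(√2·l). -/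
noncomputable section

lemma smul_add_smul_mem_H2 {p v : V3} (hp : p ∈ H2) (hpv : mink p v = 0)
    (hvv : mink v v = 1 / 2) {a b : ℝ} (ha : 0 < a) (hab : b ^ 2 = 2 * (a ^ 2 - 1)) :
    a • p + b • v ∈ H2 := by
  obtain ⟨p₁, p₂, p₃⟩ := p
  obtain ⟨v₁, v₂, v₃⟩ := v
  obtain ⟨hpp, hp₁⟩ := hp
  simp only [mink] at hpp hpv hvv hp₁
  refine ⟨?_, ?_⟩
  · simp only [mink, Prod.fst_add, Prod.snd_add, Prod.smul_fst, Prod.smul_snd, smul_eq_mul]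
    linear_combination a ^ 2 * hpp + 2 * a * b * hpv + b ^ 2 * hvv + hab / 2
  · simp only [Prod.fst_add, Prod.smul_fst, smul_eq_mul]
    have hv₁ : v₁ ^ 2 ≤ (p₁ ^ 2 - 1) / 2 := by
      have h : (p₁ ^ 2 - 1) / 2 - v₁ ^ 2 = (p₂ * v₃ - p₃ * v₂) ^ 2 := by
        have h₁ : p₁ * v₁ = p₂ * v₂ + p₃ * v₃ := by linarith
        have h₂ : p₂ ^ 2 + p₃ ^ 2 = p₁ ^ 2 - 1 := by linarith
        have h₃ : v₂ ^ 2 + v₃ ^ 2 = v₁ ^ 2 + 1 / 2 := by linarith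
        linear_combination -(p₁ * v₁ + p₂ * v₂ + p₃ * v₃) * h₁
          - (v₂ ^ 2 + v₃ ^ 2) * h₂ - (p₁ ^ 2 - 1) * h₃
      linarith [sq_nonneg (p₂ * v₃ - p₃ * v₂)]
    have hlt : (b * v₁) ^ 2 < (a * p₁) ^ 2 := by
      have h := mul_le_mul_of_nonneg_left hv₁ (sq_nonneg b)
      have ha' : 1 ≤ a ^ 2 := by linarith [sq_nonneg b]
      have hp' : 1 ≤ p₁ ^ 2 := by linarith [sq_nonneg v₁]
      have hb : b ^ 2 * ((p₁ ^ 2 - 1) / 2) = (a ^ 2 - 1) * (p₁ ^ 2 - 1) := by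
        rw [hab]; ring
      rw [mul_pow, mul_pow]
      linarith
    linarith [(abs_lt.mp (abs_lt_of_sq_lt_sq hlt (mul_pos ha hp₁).le)).1]

lemma mink_smul_add_smul_sub (p v : V3) (a b : ℝ) :
    mink (a • p + b • v) (a • p - b • v) = a ^ 2 * mink p p - b ^ 2 * mink v v := by
  simp only [mink, Prod.fst_add, Prod.snd_add, Prod.fst_sub, Prod.snd_sub, Prod.smul_fst,
    Prod.smul_snd, smul_eq_mul]
  ring

/-- For p ∈ H², v tangent with ⟪v,v⟫ = 1/2, and
x = cosh(l/√2)p + √2 sinh(l/√2)v, y = cosh(l/√2)p − √2 sinh(l/√2)v, one has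
x, y ∈ H² and ⟪x,y⟫ = −cosh(√2 l): the tube of radius l over the diagonal
surface lies in M_τ with τ = −cosh(√2 l). -/
theorem tube_over_diagonal_lies_in_M_tau (p v : V3)
    (hp : p ∈ H2) (hpv : mink p v = 0) (hvv : mink v v = 1 / 2)
    (l : ℝ) (x y : V3)
    (hx : x = Real.cosh (l / Real.sqrt 2) • p
      + (Real.sqrt 2 * Real.sinh (l / Real.sqrt 2)) • v)
    (hy : y = Real.cosh (l / Real.sqrt 2) • p
      - (Real.sqrt 2 * Real.sinh (l / Real.sqrt 2)) • v) :
    x ∈ H2 ∧ y ∈ H2 ∧ mink x y = -Real.cosh (Real.sqrt 2 * l) := by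
  have h2 : Real.sqrt 2 ^ 2 = 2 := Real.sq_sqrt (by norm_num)
  have hcs := Real.cosh_sq (l / Real.sqrt 2)
  have hab : (Real.sqrt 2 * Real.sinh (l / Real.sqrt 2)) ^ 2
      = 2 * (Real.cosh (l / Real.sqrt 2) ^ 2 - 1) := by
    rw [mul_pow, h2, hcs]; ring
  have ha := Real.cosh_pos (l / Real.sqrt 2)
  have hl : Real.sqrt 2 * l = 2 * (l / Real.sqrt 2) := by
    field_simp
    rw [h2, mul_comm]
  subst hx hy
  refine ⟨smul_add_smul_mem_H2 hp hpv hvv ha hab, ?_, ?_⟩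
  · rw [sub_eq_add_neg, ← neg_smul]
    exact smul_add_smul_mem_H2 hp hpv hvv ha (by rw [neg_sq, hab])
  · rw [mink_smul_add_smul_sub, hp.1, hvv, hab, hl, Real.cosh_two_mul]
    linarith
end
end

section
/- For every u > 0 and r ∈ ℝ, the matrix G₁(u,r) = [[(1+u²+r²u²)/(2u), r, (1−u²−r²u²)/(2u)], [ru, 1, −ru], [(1+r²u²−u²)/(2u), r, (1−r²u²+u²)/(2u)]] satisfies G₁(u,r)ᵀ · η · G₁(u,r) = η, where η = diag(−1,1,1), and its (1,1)-entry is positive; that is, G₁(u,r) belongs to the ortochronous Lorentz group O⁺(1,2) and hence acts as an isometry of H². -/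
noncomputable section

open Matrix

/-- For every u > 0 and r ∈ ℝ, the matrix G₁(u,r) satisfies
G₁ᵀ·η·G₁ = η with η = diag(−1,1,1), and has positive (1,1)-entry; that is,
G₁(u,r) lies in the ortochronous Lorentz group O⁺(1,2) and hence acts as an
isometry of H². -/
theorem G1_in_orthochronous_Lorentz_group (u r : ℝ) (hu : 0 < u)
    (G1 η : Matrix (Fin 3) (Fin 3) ℝ)
    (hG1 : G1 = !![(1 + u ^ 2 + r ^ 2 * u ^ 2) / (2 * u), r,
                     (1 - u ^ 2 - r ^ 2 * u ^ 2) / (2 * u);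
                   r * u, 1, -(r * u);
                   (1 + r ^ 2 * u ^ 2 - u ^ 2) / (2 * u), r,
                     (1 - r ^ 2 * u ^ 2 + u ^ 2) / (2 * u)])
    (hη : η = !![-1, 0, 0; 0, 1, 0; 0, 0, 1]) :
    G1ᵀ * η * G1 = η ∧ 0 < G1 0 0 := by
  have hu0 : u ≠ 0 := hu.ne'
  subst hG1 hη
  constructor
  · ext i j
    fin_cases i <;> fin_cases j <;>
      simp [Matrix.mul_apply, Fin.sum_univ_three] <;> field_simp <;> ring
  · simp only [of_apply, cons_val]
    positivity
end
end

section
/- Let C ∈ (−1,1), set C⁺ = √((1+C)/2) and C⁻ = √((1−C)/2), let (A_{ij})_{1≤i,j≤3} be a symmetric real matrix, and put H = A₁₁+A₂₂+A₃₃, H_{ij} = A_{ii}A_{jj} − A_{ij}², K = det(A_{ij}), and ρ = 2(H₁₂+H₁₃+H₂₃) − 2. Define F : ℝ → ℝ by F(l) = (1 − lA₁₁)cosh(C⁻l)cosh(C⁺l) + (−A₂₂ + lH₁₂)·sinh(C⁺l)cosh(C⁻l)/C⁺ + (−A₃₃ + lH₁₃)·sinh(C⁻l)cosh(C⁺l)/C⁻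 + (H₂₃ − lK)·sinh(C⁺l)sinh(C⁻l)/(C⁺C⁻). Then F(0) = 1, F'(0) = −H, F''(0) = ρ + 3, F⁽⁴⁾(0) = 6 − C² + (4−4C)H₁₂ + (4+4C)H₁₃ + 2ρ, F⁽⁶⁾(0) = 12 − 5C² + (16−12C−4C²)H₁₂ + (16+12C−4C²)H₁₃ + (4−C²)ρ, and F⁽⁸⁾(0) = 24 − 16C² + C⁴ + (8−4C²)ρ + (48−32C−24C²+8C³)H₁₂ + (48+32C−24C²−8C³)H₁₃. -/
/-- Combination of the products of `cosh (p * l)`, `sinh (p * l) / p` with `cosh (m * l)`,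
`sinh (m * l) / m`, whose coefficients are affine in `l`. -/
noncomputable def hypComb (p m a₀ b₀ c₀ d₀ a₁ b₁ c₁ d₁ l : ℝ) : ℝ :=
  (a₀ + l * a₁) * (Real.cosh (p * l) * Real.cosh (m * l))
    + (b₀ + l * b₁) * (Real.sinh (p * l) / p * Real.cosh (m * l))
    + (c₀ + l * c₁) * (Real.cosh (p * l) * (Real.sinh (m * l) / m))
    + (d₀ + l * d₁) * (Real.sinh (p * l) / p * (Real.sinh (m * l) / m))

theorem hypComb_zero (p m a₀ b₀ c₀ d₀ a₁ b₁ c₁ d₁ : ℝ) :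
    hypComb p m a₀ b₀ c₀ d₀ a₁ b₁ c₁ d₁ 0 = a₀ := by
  simp [hypComb]

theorem deriv_hypComb {p m : ℝ} (hp : p ≠ 0) (hm : m ≠ 0) (a₀ b₀ c₀ d₀ a₁ b₁ c₁ d₁ : ℝ) :
    deriv (hypComb p m a₀ b₀ c₀ d₀ a₁ b₁ c₁ d₁) =
      hypComb p m (a₁ + b₀ + c₀) (b₁ + p ^ 2 * a₀ + d₀) (c₁ + m ^ 2 * a₀ + d₀)
        (d₁ + m ^ 2 * b₀ + p ^ 2 * c₀)
        (b₁ + c₁) (p ^ 2 * a₁ + d₁) (m ^ 2 * a₁ + d₁) (m ^ 2 * b₁ + p ^ 2 * c₁) := by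
  funext l
  have affine (x y : ℝ) : HasDerivAt (fun t : ℝ => x + t * y) (1 * y) l :=
    ((hasDerivAt_id' l).mul_const y).const_add x
  have lin (k : ℝ) : HasDerivAt (fun t : ℝ => k * t) (k * 1) l :=
    (hasDerivAt_id' l).const_mul k
  have cp := (lin p).cosh
  have cm := (lin m).cosh
  have sp := (lin p).sinh.div_const p
  have sm := (lin m).sinh.div_const m
  have h := ((((affine a₀ a₁).mul (cp.mul cm)).add ((affine b₀ b₁).mul (sp.mul cm))).add
    ((affine c₀ c₁).mul (cp.mul sm))).add ((affine d₀ d₁).mul (sp.mul sm))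
  refine (h.deriv : deriv (hypComb p m a₀ b₀ c₀ d₀ a₁ b₁ c₁ d₁) l = _).trans ?_
  simp only [hypComb, Pi.mul_apply]
  field_simp
  ring

theorem iteratedDeriv_add_two_hypComb {p m : ℝ} (hp : p ≠ 0) (hm : m ≠ 0)
    (hpm : p ^ 2 + m ^ 2 = 1) (n : ℕ) (a₀ b₀ c₀ d₀ a₁ b₁ c₁ d₁ : ℝ) :
    iteratedDeriv (n + 2) (hypComb p m a₀ b₀ c₀ d₀ a₁ b₁ c₁ d₁) =
      iteratedDeriv n (hypComb p m
        (a₀ + 2 * d₀ + 2 * (b₁ + c₁)) (b₀ + 2 * p ^ 2 * c₀ + 2 * (p ^ 2 * a₁ + d₁))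
        (c₀ + 2 * m ^ 2 * b₀ + 2 * (m ^ 2 * a₁ + d₁))
        (d₀ + 2 * p ^ 2 * m ^ 2 * a₀ + 2 * (m ^ 2 * b₁ + p ^ 2 * c₁))
        (a₁ + 2 * d₁) (b₁ + 2 * p ^ 2 * c₁) (c₁ + 2 * m ^ 2 * b₁)
        (d₁ + 2 * p ^ 2 * m ^ 2 * a₁)) := by
  rw [iteratedDeriv_succ', iteratedDeriv_succ', deriv_hypComb hp hm, deriv_hypComb hp hm]
  have hm2 : m ^ 2 = 1 - p ^ 2 := by linarith
  rw [hm2]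
  congr 2 <;> ring

/-- Derivatives at 0 of the determinant function
F(l) = det Q(l) of the parallel-hypersurface matrix, in terms of the
symmetric shape-operator components A_{ij}, the constant C ∈ (−1,1),
the mean curvature H, the minors H_{ij}, K = det A and
ρ = 2(H₁₂+H₁₃+H₂₃) − 2. -/
theorem derivatives_of_parallel_determinant (C : ℝ) (hC₁ : -1 < C) (hC₂ : C < 1)
    (A : Matrix (Fin 3) (Fin 3) ℝ) (hA : A.IsSymm)
    (Cp Cm H H12 H13 H23 K ρ : ℝ)
    (hCp : Cp = Real.sqrt ((1 + C) / 2)) (hCm : Cm = Real.sqrt ((1 - C) / 2))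
    (hH : H = A 0 0 + A 1 1 + A 2 2)
    (hH12 : H12 = A 0 0 * A 1 1 - (A 0 1) ^ 2)
    (hH13 : H13 = A 0 0 * A 2 2 - (A 0 2) ^ 2)
    (hH23 : H23 = A 1 1 * A 2 2 - (A 1 2) ^ 2)
    (hK : K = A.det)
    (hρ : ρ = 2 * (H12 + H13 + H23) - 2)
    (F : ℝ → ℝ)
    (hF : ∀ l, F l =
      (1 - l * A 0 0) * Real.cosh (Cm * l) * Real.cosh (Cp * l)
      + (-(A 1 1) + l * H12) * Real.sinh (Cp * l) * Real.cosh (Cm * l) / Cp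
      + (-(A 2 2) + l * H13) * Real.sinh (Cm * l) * Real.cosh (Cp * l) / Cm
      + (H23 - l * K) * Real.sinh (Cp * l) * Real.sinh (Cm * l) / (Cp * Cm)) :
    F 0 = 1 ∧
    deriv F 0 = -H ∧
    iteratedDeriv 2 F 0 = ρ + 3 ∧
    iteratedDeriv 4 F 0 = 6 - C ^ 2 + (4 - 4 * C) * H12 + (4 + 4 * C) * H13 + 2 * ρ ∧
    iteratedDeriv 6 F 0 = 12 - 5 * C ^ 2 + (16 - 12 * C - 4 * C ^ 2) * H12
      + (16 + 12 * C - 4 * C ^ 2) * H13 + (4 - C ^ 2) * ρ ∧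
    iteratedDeriv 8 F 0 = 24 - 16 * C ^ 2 + C ^ 4 + (8 - 4 * C ^ 2) * ρ
      + (48 - 32 * C - 24 * C ^ 2 + 8 * C ^ 3) * H12
      + (48 + 32 * C - 24 * C ^ 2 - 8 * C ^ 3) * H13 := by
  have hp : Cp ≠ 0 := by rw [hCp]; exact (Real.sqrt_pos.2 (by linarith)).ne'
  have hm : Cm ≠ 0 := by rw [hCm]; exact (Real.sqrt_pos.2 (by linarith)).ne'
  have hp2 : Cp ^ 2 = (1 + C) / 2 := by rw [hCp]; exact Real.sq_sqrt (by linarith)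
  have hm2 : Cm ^ 2 = (1 - C) / 2 := by rw [hCm]; exact Real.sq_sqrt (by linarith)
  have hpm : Cp ^ 2 + Cm ^ 2 = 1 := by rw [hp2, hm2]; ring
  have hFG : F = hypComb Cp Cm 1 (-(A 1 1)) (-(A 2 2)) H23 (-(A 0 0)) H12 H13 (-K) := by
    funext l
    rw [hF, hypComb]
    field_simp
    ring
  have two := iteratedDeriv_add_two_hypComb hp hm hpm
  rw [hFG]
  refine ⟨hypComb_zero .., ?_, ?_, ?_, ?_, ?_⟩
  · rw [deriv_hypComb hp hm, hypComb_zero, hH]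
    ring
  · rw [two 0, iteratedDeriv_zero, hypComb_zero, hρ]
    ring
  · rw [two 2, two 0, iteratedDeriv_zero, hypComb_zero, hρ, hp2, hm2]
    ring
  · rw [two 4, two 2, two 0, iteratedDeriv_zero, hypComb_zero, hρ, hp2, hm2]
    ring
  · rw [two 6, two 4, two 2, two 0, iteratedDeriv_zero, hypComb_zero, hρ, hp2, hm2]
    ring
end

section
/- Let C, ρ, H₁₂, H₁₃, α₁, α₂ be real numbers with C ≠ 0, C ≠ 1 and C ≠ −1, and suppose that 6 − C² + (4−4C)H₁₂ + (4+4C)H₁₃ + 2ρ = α₁ and 12 − 5C² + (16−12C−4C²)H₁₂ + (16+12C−4C²)H₁₃ + (4−C²)ρ = α₂. Then H₁₂ = (12 − 6C + C² + C³ − (4−C)α₁ + α₂ + (4−2C+C²)ρ)/(8C(1−C)), H₁₃ = −(12 + 6C + C² − C³ − (4+C)α₁ + α₂ + (4+2C+C²)ρ)/(8C(1+C)), and 24 − 16C² + C⁴ + (8−4C²)ρ + (48−32C−24C²+8C³)H₁₂ + (48+32C−24C²−8C³)H₁₃ = 12C² − C⁴ − (4+2C²)α₁ + 4α₂ + 4C²ρ.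 In particular, if ρ, α₁, α₂ and the left-hand side above are constant, then C satisfies a nontrivial polynomial equation with constant coefficients. -/
/-- Algebraic elimination in the isoparametric classification:
if C ≠ 0, ±1 and the 4th and 6th derivative expressions equal α₁, α₂, then H₁₂
and H₁₃ are determined by the displayed formulas and the 8th derivative
expression equals 12C² − C⁴ − (4+2C²)α₁ + 4α₂ + 4C²ρ, a polynomial relation
in C alone once ρ, α₁, α₂ and that expression are constant. -/
theorem isoparametric_elimination (C ρ H12 H13 α₁ α₂ : ℝ)
    (h0 : C ≠ 0) (h1 : C ≠ 1) (h2 : C ≠ -1)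
    (e1 : 6 - C ^ 2 + (4 - 4 * C) * H12 + (4 + 4 * C) * H13 + 2 * ρ = α₁)
    (e2 : 12 - 5 * C ^ 2 + (16 - 12 * C - 4 * C ^ 2) * H12
      + (16 + 12 * C - 4 * C ^ 2) * H13 + (4 - C ^ 2) * ρ = α₂) :
    H12 = (12 - 6 * C + C ^ 2 + C ^ 3 - (4 - C) * α₁ + α₂
        + (4 - 2 * C + C ^ 2) * ρ) / (8 * C * (1 - C)) ∧
    H13 = -((12 + 6 * C + C ^ 2 - C ^ 3 - (4 + C) * α₁ + α₂
        + (4 + 2 * C + C ^ 2) * ρ) / (8 * C * (1 + C))) ∧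
    24 - 16 * C ^ 2 + C ^ 4 + (8 - 4 * C ^ 2) * ρ
        + (48 - 32 * C - 24 * C ^ 2 + 8 * C ^ 3) * H12
        + (48 + 32 * C - 24 * C ^ 2 - 8 * C ^ 3) * H13
      = 12 * C ^ 2 - C ^ 4 - (4 + 2 * C ^ 2) * α₁ + 4 * α₂ + 4 * C ^ 2 * ρ := by
  have h1' : 1 - C ≠ 0 := sub_ne_zero.mpr h1.symm
  have h2' : 1 + C ≠ 0 := fun h => h2 (by linarith)
  refine ⟨?_, ?_, ?_⟩
  · rw [eq_div_iff (by positivity)]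
    linear_combination e2 - (4 - C) * e1
  · rw [eq_neg_iff_add_eq_zero, add_comm, ← eq_neg_iff_add_eq_zero, div_eq_iff (by positivity)]
    linear_combination (4 + C) * e1 - e2
  · linear_combination 4 * e2 - (4 + 2 * C ^ 2) * e1
end

section
/- Let C, λ₁, λ₂, P₁₁, P₂₂ be real numbers with C ≠ 0, λ₁ ≠ 0, λ₂ ≠ 0, satisfying P₂₂ = −P₁₁, (−1 + C² + 2λ₁²)·P₁₁ = 2Cλ₁² and (−1 + C² + 2λ₂²)·P₂₂ = 2Cλ₂². Then C²(λ₁² + λ₂²) = λ₁² + λ₂² − 4λ₁²λ₂². Moreover, if in addition C² = 1 − 2λ₁λ₂, then λ₁ = λ₂. -/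
/-- Algebraic core of Case (3)-i in Theorem 1.1: if C ≠ 0,
λ₁, λ₂ ≠ 0, P₂₂ = −P₁₁ and the two Codazzi-derived relations hold, then
C²(λ₁² + λ₂²) = λ₁² + λ₂² − 4λ₁²λ₂²; moreover, if in addition C² = 1 − 2λ₁λ₂,
then λ₁ = λ₂. -/
theorem codazzi_algebra_three_principal_curvatures (C lam1 lam2 P11 P22 : ℝ)
    (hC : C ≠ 0) (h1 : lam1 ≠ 0) (h2 : lam2 ≠ 0)
    (hP : P22 = -P11)
    (e1 : (-1 + C ^ 2 + 2 * lam1 ^ 2) * P11 = 2 * C * lam1 ^ 2)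
    (e2 : (-1 + C ^ 2 + 2 * lam2 ^ 2) * P22 = 2 * C * lam2 ^ 2) :
    C ^ 2 * (lam1 ^ 2 + lam2 ^ 2) = lam1 ^ 2 + lam2 ^ 2 - 4 * lam1 ^ 2 * lam2 ^ 2 ∧
    (C ^ 2 = 1 - 2 * lam1 * lam2 → lam1 = lam2) := by
  have hP11 : P11 ≠ 0 := by
    rintro rfl
    simp_all
  have key : C ^ 2 * (lam1 ^ 2 + lam2 ^ 2) =
      lam1 ^ 2 + lam2 ^ 2 - 4 * lam1 ^ 2 * lam2 ^ 2 := by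
    subst hP
    apply mul_left_cancel₀ hP11
    linear_combination lam2 ^ 2 * e1 - lam1 ^ 2 * e2
  refine ⟨key, fun h => ?_⟩
  have hsq : (lam1 - lam2) ^ 2 = 0 := by
    apply mul_left_cancel₀ (mul_ne_zero h1 h2)
    linear_combination (lam1 ^ 2 + lam2 ^ 2) / 2 * h - key / 2
  exact sub_eq_zero.mp (pow_eq_zero_iff two_ne_zero |>.mp hsq)
end
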